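/- Fix q ∈ ℝ with q ≠ 0 and q² ≠ 1, and write [2]_q = q + q⁻¹. The S-Heun operators on the q-linear grid, L̂ = (q−q⁻¹)⁻¹z⁻¹(T̂₊−T̂₋), M̂₁ = (q−q⁻¹)⁻¹(−q⁻¹T̂₊+qT̂₋), M̂₂ = (q−q⁻¹)⁻¹(T̂₊−T̂₋), R̂₁ = (q−q⁻¹)⁻¹z(−q⁻¹T̂₊+qT̂₋), R̂₂ = (q−q⁻¹)⁻¹z(T̂₊−T̂₋), satisfy, pointwise at all z ≠ 0 on all functions f : ℝ → ℝ, the fourteen homogeneous quadratic reordering relations: M̂₁L̂ = [2]_q L̂M̂₁ + L̂M̂₂; M̂₂L̂ = −L̂M̂₁; M̂₂M̂₁ = M̂₁M̂₂; [2]_q M̂₁M̂₂ = 1 − M̂₁² − M̂₂²; L̂R̂₁ = 1 − M̂₂²; L̂R̂₂ = [2]_q M̂₂² + M̂₁M̂₂; R̂₁L̂ = 1 − M̂₁²; R̂₂L̂ = −M̂₁M̂₂; [2]_q R̂₁R̂₂ = −R̂₁² − R̂₂²; R̂₁M̂₁ = −[2]_q² M̂₁R̂₂ − [2]_q M̂₂R̂₂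 + M̂₂R̂₁; R̂₁M̂₂ = [2]_q M̂₁R̂₂ + M̂₂R̂₂; R̂₂M̂₁ = [2]_q M̂₁R̂₂ + M̂₂R̂₂; R̂₂M̂₂ = −M̂₁R̂₂; M̂₁R̂₁ = −[2]_q M̂₁R̂₂ − M̂₂R̂₂. -/

import Mathlib

/-- Lowering S-Heun operator `L̂ = (q−q⁻¹)⁻¹ z⁻¹(T̂₊−T̂₋)` on the q-linear grid. -/
noncomputable def hL (q : ℝ) (f : ℝ → ℝ) : ℝ → ℝ :=
  fun z => (q - q⁻¹)⁻¹ * z⁻¹ * (f (q*z) - f (q⁻¹*z))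
/-- Stabilizing S-Heun operator `M̂₁ = (q−q⁻¹)⁻¹(−q⁻¹T̂₊+qT̂₋)`. -/
noncomputable def hM1 (q : ℝ) (f : ℝ → ℝ) : ℝ → ℝ :=
  fun z => (q - q⁻¹)⁻¹ * (-q⁻¹ * f (q*z) + q * f (q⁻¹*z))
/-- Stabilizing S-Heun operator `M̂₂ = (q−q⁻¹)⁻¹(T̂₊−T̂₋)`. -/
noncomputable def hM2 (q : ℝ) (f : ℝ → ℝ) : ℝ → ℝ :=
  fun z => (q - q⁻¹)⁻¹ * (f (q*z) - f (q⁻¹*z))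
/-- Raising S-Heun operator `R̂₁ = (q−q⁻¹)⁻¹ z(−q⁻¹T̂₊+qT̂₋)`. -/
noncomputable def hR1 (q : ℝ) (f : ℝ → ℝ) : ℝ → ℝ :=
  fun z => (q - q⁻¹)⁻¹ * z * (-q⁻¹ * f (q*z) + q * f (q⁻¹*z))
/-- Raising S-Heun operator `R̂₂ = (q−q⁻¹)⁻¹ z(T̂₊−T̂₋)`. -/
noncomputable def hR2 (q : ℝ) (f : ℝ → ℝ) : ℝ → ℝ :=
  fun z => (q - q⁻¹)⁻¹ * z * (f (q*z) - f (q⁻¹*z))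

/-- The fourteen homogeneous quadratic reordering relations between the S-Heun
operators on the q-linear grid, with `[2]_q = q + q⁻¹`. -/
theorem stmt_19 (q : ℝ) (hq : q ≠ 0) (hq2 : q^2 ≠ 1) :
    (∀ (f : ℝ → ℝ) (z : ℝ), z ≠ 0 →
      hM1 q (hL q f) z = (q + q⁻¹) * hL q (hM1 q f) z + hL q (hM2 q f) z) ∧
    (∀ (f : ℝ → ℝ) (z : ℝ), z ≠ 0 →
      hM2 q (hL q f) z = -(hL q (hM1 q f) z)) ∧
    (∀ (f : ℝ → ℝ) (z : ℝ), z ≠ 0 →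
      hM2 q (hM1 q f) z = hM1 q (hM2 q f) z) ∧
    (∀ (f : ℝ → ℝ) (z : ℝ), z ≠ 0 →
      (q + q⁻¹) * hM1 q (hM2 q f) z
        = f z - hM1 q (hM1 q f) z - hM2 q (hM2 q f) z) ∧
    (∀ (f : ℝ → ℝ) (z : ℝ), z ≠ 0 →
      hL q (hR1 q f) z = f z - hM2 q (hM2 q f) z) ∧
    (∀ (f : ℝ → ℝ) (z : ℝ), z ≠ 0 →
      hL q (hR2 q f) z = (q + q⁻¹) * hM2 q (hM2 q f) z + hM1 q (hM2 q f) z) ∧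
    (∀ (f : ℝ → ℝ) (z : ℝ), z ≠ 0 →
      hR1 q (hL q f) z = f z - hM1 q (hM1 q f) z) ∧
    (∀ (f : ℝ → ℝ) (z : ℝ), z ≠ 0 →
      hR2 q (hL q f) z = -(hM1 q (hM2 q f) z)) ∧
    (∀ (f : ℝ → ℝ) (z : ℝ), z ≠ 0 →
      (q + q⁻¹) * hR1 q (hR2 q f) z
        = -(hR1 q (hR1 q f) z) - hR2 q (hR2 q f) z) ∧
    (∀ (f : ℝ → ℝ) (z : ℝ), z ≠ 0 →
      hR1 q (hM1 q f) z
        = -((q + q⁻¹)^2 * hM1 q (hR2 q f) z) - (q + q⁻¹) * hM2 q (hR2 q f) z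
          + hM2 q (hR1 q f) z) ∧
    (∀ (f : ℝ → ℝ) (z : ℝ), z ≠ 0 →
      hR1 q (hM2 q f) z = (q + q⁻¹) * hM1 q (hR2 q f) z + hM2 q (hR2 q f) z) ∧
    (∀ (f : ℝ → ℝ) (z : ℝ), z ≠ 0 →
      hR2 q (hM1 q f) z = (q + q⁻¹) * hM1 q (hR2 q f) z + hM2 q (hR2 q f) z) ∧
    (∀ (f : ℝ → ℝ) (z : ℝ), z ≠ 0 →
      hR2 q (hM2 q f) z = -(hM1 q (hR2 q f) z)) ∧
    (∀ (f : ℝ → ℝ) (z : ℝ), z ≠ 0 →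
      hM1 q (hR1 q f) z
        = -((q + q⁻¹) * hM1 q (hR2 q f) z) - hM2 q (hR2 q f) z) := by
  have hd : q ^ 2 - 1 ≠ 0 := sub_ne_zero.mpr hq2
  have hi : (q - q⁻¹)⁻¹ = q / (q ^ 2 - 1) := by
    have : q - q⁻¹ = (q ^ 2 - 1) / q := by field_simp
    rw [this, inv_div]
  refine ⟨?_, ?_, ?_, ?_, ?_, ?_, ?_, ?_, ?_, ?_, ?_, ?_, ?_, ?_⟩ <;>
  · intro f z hz
    have h1 : q * (q⁻¹ * z) = z := by field_simp
    have h2 : q⁻¹ * (q * z) = z := by field_simp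
    simp only [hL, hM1, hM2, hR1, hR2, h1, h2, hi]
    generalize f (q * (q * z)) = a
    generalize f (q⁻¹ * (q⁻¹ * z)) = b
    generalize f z = c
    field_simp
    try ring
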